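/- arXiv:1704.02730 — 3 statements merged into one kernel-verified Lean document; each statement's English description precedes it below -/
import Mathlib

section
/- Let μ, ν be compactly supported, atomless Borel probability measures on ℝ, λ_C := W∞(μ,ν), and let γ̄ ∈ Π(μ,ν) be an ∞-cyclically monotone optimal transport plan. Then for any x̄ ∈ M_γ̄^+, the open interval (x̄, x̄+2λ_C) has empty intersection with M_γ̄^-; similarly, for any x̄ ∈ M_γ̄^-, the interval (x̄−2λ_C, x̄) has empty intersection with M_γ̄^+. -/
open MeasureTheory Set Filter Topology
open scoped ENNReal NNReal

noncomputable section

/-- Topological support of a measure: points all of whose open neighborhoods have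
positive measure. -/
def mSupport {α : Type*} [TopologicalSpace α] [MeasurableSpace α] (γ : Measure α) : Set α :=
  {x | ∀ U : Set α, IsOpen U → x ∈ U → 0 < γ U}

/-- γ is a transport plan (coupling) between μ and ν. -/
def IsCoupling {α : Type*} [MeasurableSpace α] (μ ν : Measure α) (γ : Measure (α × α)) : Prop :=
  γ.fst = μ ∧ γ.snd = ν

/-- The γ-essential supremum of the distance |x - y|. -/
def costInf {α : Type*} [MeasurableSpace α] [PseudoEMetricSpace α]
    (γ : Measure (α × α)) : ℝ≥0∞ :=
  essSup (fun p => edist p.1 p.2) γ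

/-- The L^∞ optimal transport cost W∞(μ, ν). -/
def Winfty {α : Type*} [MeasurableSpace α] [PseudoEMetricSpace α] (μ ν : Measure α) : ℝ≥0∞ :=
  ⨅ (γ : Measure (α × α)) (_ : IsCoupling μ ν γ), costInf γ

/-- γ is an optimal plan for the L^∞ optimal transport problem. -/
def IsOptimalPlan {α : Type*} [MeasurableSpace α] [PseudoEMetricSpace α]
    (μ ν : Measure α) (γ : Measure (α × α)) : Prop :=
  IsCoupling μ ν γ ∧ costInf γ = Winfty μ ν

/-- μ is compactly supported. -/
def CompactlySupported {α : Type*} [TopologicalSpace α] [MeasurableSpace α]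
    (μ : Measure α) : Prop :=
  ∃ K : Set α, IsCompact K ∧ μ Kᶜ = 0

/-- The admissible class U_λ of the dual problem. -/
def DualAdm {α : Type*} [MeasurableSpace α] [PseudoMetricSpace α]
    (μ ν : Measure α) (lam : ℝ) (φ ψ : α → ℝ) : Prop :=
  Integrable φ μ ∧ Integrable ψ ν ∧
    ∀ᵐ x ∂μ, ∀ᵐ y ∂ν, dist x y ≤ lam → φ x + ψ y ≤ 0

/-- ∞-cyclical monotonicity of a plan on ℝ. -/
def InfCM (γ : Measure (ℝ × ℝ)) : Prop :=
  ∀ (n : ℕ) (p : Fin (n + 1) → ℝ × ℝ), (∀ i, p i ∈ mSupport γ) →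
    (⨆ i, |(p i).1 - (p i).2|) ≤ ⨆ i, |(p i).1 - (p (i + 1)).2|

/-- Points moved at maximal distance to the right. -/
def Mplus (γ : Measure (ℝ × ℝ)) (lam : ℝ) : Set ℝ := {x | (x, x + lam) ∈ mSupport γ}

/-- Points moved at maximal distance to the left. -/
def Mminus (γ : Measure (ℝ × ℝ)) (lam : ℝ) : Set ℝ := {x | (x, x - lam) ∈ mSupport γ}


/-- In an ∞-cyclically monotone plan, a point moved by `lam` to the right and a point moved by
`lam` to the left cannot be at positive distance less than `2 * lam`, the latter on the right. -/
lemma InfCM.not_lt_of_mem_Mplus_of_mem_Mminus {γ : Measure (ℝ × ℝ)} (hcm : InfCM γ)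
    {lam x y : ℝ} (hx : x ∈ Mplus γ lam) (hy : y ∈ Mminus γ lam) (hxy : x < y) :
    ¬ y < x + 2 * lam := by
  intro hlt
  have hsupp : ∀ i, (![(x, x + lam), (y, y - lam)] : Fin 2 → ℝ × ℝ) i ∈ mSupport γ := by
    intro i
    fin_cases i
    · exact hx
    · exact hy
  have hle := (le_ciSup (Set.finite_range _).bddAbove (0 : Fin 2)).trans (hcm 1 _ hsupp)
  obtain ⟨i, hi⟩ := exists_eq_ciSup_of_finite
    (f := fun i : Fin 2 => |((![(x, x + lam), (y, y - lam)] : Fin 2 → ℝ × ℝ) i).1 -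
      ((![(x, x + lam), (y, y - lam)] : Fin 2 → ℝ × ℝ) (i + 1)).2|)
  have hlam : lam ≤ |x - (x + lam)| := by
    rw [abs_sub_comm, add_sub_cancel_left]
    exact le_abs_self lam
  have hbound : lam ≤ |((![(x, x + lam), (y, y - lam)] : Fin 2 → ℝ × ℝ) i).1 -
      ((![(x, x + lam), (y, y - lam)] : Fin 2 → ℝ × ℝ) (i + 1)).2| :=
    hlam.trans (hle.trans hi.ge)
  refine absurd hbound (not_le.mpr ?_)
  fin_cases i
  · change |x - (y - lam)| < lam
    rw [abs_lt]
    constructor <;> linarith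
  · change |y - (x + lam)| < lam
    rw [abs_lt]
    constructor <;> linarith

/-- If x̄ is moved at maximal distance to the right by an ∞-cyclically monotone optimal
plan, then no point of (x̄, x̄ + 2λ_C) is moved at maximal distance to the left;
and symmetrically. -/
theorem maximal_displacement_separation (μ ν : Measure ℝ)
    [IsProbabilityMeasure μ] [IsProbabilityMeasure ν] [NullSingletonClass μ] [NullSingletonClass ν]
    (hμ : CompactlySupported μ) (hν : CompactlySupported ν)
    (γ : Measure (ℝ × ℝ)) (hγ : IsOptimalPlan μ ν γ) (hcm : InfCM γ) :
    (∀ x₀ ∈ Mplus γ (Winfty μ ν).toReal,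
      Set.Ioo x₀ (x₀ + 2 * (Winfty μ ν).toReal) ∩ Mminus γ (Winfty μ ν).toReal = ∅) ∧
    (∀ x₀ ∈ Mminus γ (Winfty μ ν).toReal,
      Set.Ioo (x₀ - 2 * (Winfty μ ν).toReal) x₀ ∩ Mplus γ (Winfty μ ν).toReal = ∅) := by
  constructor
  · intro x hx
    refine Set.eq_empty_of_forall_notMem fun y hy => ?_
    exact hcm.not_lt_of_mem_Mplus_of_mem_Mminus hx hy.2 hy.1.1 hy.1.2
  · intro y hy
    refine Set.eq_empty_of_forall_notMem fun x hx => ?_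
    exact hcm.not_lt_of_mem_Mplus_of_mem_Mminus hx.2 hy hx.1.2 (by linarith [hx.1.1])

end
end

section
/- In the setting of the construction (μ, ν compactly supported atomless probability measures on ℝ, γ̄ an ∞-cyclically monotone optimal plan, ρ = ρ^+ − ρ^- as prescribed), define φ_r(x) := −ρ((−∞,x]) and ψ_r(y) := inf{ −φ_r(x) : x ∈ [y−λ_C, y+λ_C] }. Then the pair (φ_r, ψ_r) belongs to U_{λ_C} and satisfies ∫φ_r dμ + ∫ψ_r dν = 0, i.e. (φ_r, ψ_r) is a pair of Kantorovich potentials (a maximizer of the dual problem). -/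
open MeasureTheory Set Filter Topology
open scoped ENNReal NNReal

noncomputable section

/-- x is a left-extreme point of A: x ∈ A and some interval (x−δ, x) misses A. -/
def LeftExtreme (A : Set ℝ) (x : ℝ) : Prop :=
  x ∈ A ∧ ∃ δ > 0, Set.Ioo (x - δ) x ∩ A = ∅

/-- x is a right-extreme point of A: x ∈ A and some interval (x, x+δ) misses A. -/
def RightExtreme (A : Set ℝ) (x : ℝ) : Prop :=
  x ∈ A ∧ ∃ δ > 0, Set.Ioo x (x + δ) ∩ A = ∅

/-- Support of the signed measure ρ = ρ⁺ − ρ⁻: points each of whose open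
neighborhoods contains a measurable set on which ρ⁺ and ρ⁻ differ. -/
def suppSigned (ρp ρm : Measure ℝ) : Set ℝ :=
  {x | ∀ U : Set ℝ, IsOpen U → x ∈ U → ∃ A ⊆ U, MeasurableSet A ∧ ρp A ≠ ρm A}

/-- The potential φ_r(x) = −ρ((−∞, x]) where ρ = ρ⁺ − ρ⁻. -/
def phiR (ρp ρm : Measure ℝ) (x : ℝ) : ℝ :=
  (ρm (Set.Iic x)).toReal - (ρp (Set.Iic x)).toReal

/-- The potential ψ_r(y) = inf { −φ_r(x) : x ∈ [y − λ, y + λ] }. -/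
def psiR (ρp ρm : Measure ℝ) (lam : ℝ) (y : ℝ) : ℝ :=
  sInf ((fun x => -phiR ρp ρm x) '' Set.Icc (y - lam) (y + lam))

/-- The support of a measure in the sense of `mSupport` is `Measure.support`. -/
theorem mSupport_eq_support {α : Type*} [TopologicalSpace α] [MeasurableSpace α]
    (γ : Measure α) : mSupport γ = γ.support := by
  rw [Measure.support_eq_forall_isOpen]
  ext x
  exact ⟨fun h U hx hU => h U hU hx, fun h U hU hx => h U hx hU⟩

theorem measure_compl_mSupport {α : Type*} [TopologicalSpace α] [MeasurableSpace α]
    [HereditarilyLindelofSpace α] (γ : Measure α) : γ (mSupport γ)ᶜ = 0 := by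
  rw [mSupport_eq_support]
  exact Measure.measure_compl_support

theorem measure_eq_zero_of_disjoint_mSupport {α : Type*} [TopologicalSpace α]
    [MeasurableSpace α] [HereditarilyLindelofSpace α] {γ : Measure α} {s : Set α}
    (h : ∀ x ∈ s, x ∉ mSupport γ) : γ s = 0 :=
  measure_mono_null h (measure_compl_mSupport γ)

/-- A finite measure has countably many atoms. -/
theorem countable_setOf_measure_singleton_ne_zero {α : Type*} [MeasurableSpace α]
    [MeasurableSingletonClass α] (ρ : Measure α) [SFinite ρ] : {x | ρ {x} ≠ 0}.Countable := by
  simp only [← pos_iff_ne_zero]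
  exact Measure.countable_meas_pos_of_disjoint_iUnion (fun x => measurableSet_singleton x)
    fun x y hxy => by simpa using hxy

theorem IsCoupling.measurePreserving_fst {α : Type*} [MeasurableSpace α] {μ ν : Measure α}
    {γ : Measure (α × α)} (h : IsCoupling μ ν γ) : MeasurePreserving Prod.fst γ μ :=
  ⟨measurable_fst, h.1⟩

theorem IsCoupling.measurePreserving_snd {α : Type*} [MeasurableSpace α] {μ ν : Measure α}
    {γ : Measure (α × α)} (h : IsCoupling μ ν γ) : MeasurePreserving Prod.snd γ ν :=
  ⟨measurable_snd, h.2⟩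

/-- A coupling of compactly supported measures has finite cost. -/
theorem IsCoupling.costInf_ne_top {α : Type*} [MeasurableSpace α] [PseudoMetricSpace α]
    {μ ν : Measure α} {γ : Measure (α × α)} (h : IsCoupling μ ν γ)
    (hμ : CompactlySupported μ) (hν : CompactlySupported ν) : costInf γ ≠ ⊤ := by
  obtain ⟨K, hK, hμK⟩ := hμ
  obtain ⟨L, hL, hνL⟩ := hν
  have hb : Bornology.IsBounded (K ∪ L) := hK.isBounded.union hL.isBounded
  refine ne_top_of_le_ne_top hb.ediam_ne_top (essSup_le_of_ae_le _ ?_)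
  have h1 : ∀ᵐ p ∂γ, p.1 ∈ K :=
    h.measurePreserving_fst.quasiMeasurePreserving.ae (mem_ae_iff.2 hμK)
  have h2 : ∀ᵐ p ∂γ, p.2 ∈ L :=
    h.measurePreserving_snd.quasiMeasurePreserving.ae (mem_ae_iff.2 hνL)
  filter_upwards [h1, h2] with p hp1 hp2
  exact Metric.edist_le_ediam_of_mem (Or.inl hp1) (Or.inr hp2)

theorem IsOptimalPlan.ae_dist_le {α : Type*} [MeasurableSpace α] [PseudoMetricSpace α]
    {μ ν : Measure α} {γ : Measure (α × α)} (h : IsOptimalPlan μ ν γ)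
    (hμ : CompactlySupported μ) (hν : CompactlySupported ν) :
    ∀ᵐ p ∂γ, dist p.1 p.2 ≤ (Winfty μ ν).toReal := by
  have hfin : Winfty μ ν ≠ ⊤ := h.2 ▸ h.1.costInf_ne_top hμ hν
  filter_upwards [ENNReal.ae_le_essSup (μ := γ) fun p : α × α => edist p.1 p.2] with p hp
  rw [dist_edist]
  exact ENNReal.toReal_mono hfin (hp.trans_eq h.2)

/-- Swapping the targets of two pairs in the support of an `∞`-cyclically monotone plan. -/
theorem InfCM.abs_sub_le_max {γ : Measure (ℝ × ℝ)} (h : InfCM γ) {a b c d : ℝ}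
    (h1 : (a, b) ∈ mSupport γ) (h2 : (c, d) ∈ mSupport γ) :
    |c - d| ≤ max |a - d| |c - b| := by
  have key := h 1 ![(a, b), (c, d)] (by simp [Fin.forall_fin_two, h1, h2])
  have hle : |c - d| ≤ ⨆ i, |(![(a, b), (c, d)] i).1 - (![(a, b), (c, d)] i).2| :=
    le_ciSup (f := fun i => |(![(a, b), (c, d)] i).1 - (![(a, b), (c, d)] i).2|)
      (finite_range _).bddAbove 1
  refine hle.trans (key.trans (ciSup_le ?_))
  simp [Fin.forall_fin_two]

/-- No point strictly between `x` and `y + lam` is moved by `lam` to the left when `x` is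
sent to `y`. -/
theorem InfCM.notMem_Mminus {γ : Measure (ℝ × ℝ)} (h : InfCM γ) {lam x y m : ℝ}
    (hxy : (x, y) ∈ mSupport γ) (hd : |x - y| ≤ lam) (hxm : x < m) (hmy : m < y + lam) :
    m ∉ Mminus γ lam := by
  intro hm
  have hle := h.abs_sub_le_max hxy hm
  rw [sub_sub_cancel] at hle
  rw [abs_le] at hd
  refine absurd ((le_abs_self lam).trans hle) (not_le.2 (max_lt ?_ ?_)) <;>
    rw [abs_lt] <;> constructor <;> linarith

/-- No point strictly between `y - lam` and `x` is moved by `lam` to the right when `x` is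
sent to `y`. -/
theorem InfCM.notMem_Mplus {γ : Measure (ℝ × ℝ)} (h : InfCM γ) {lam x y m : ℝ}
    (hxy : (x, y) ∈ mSupport γ) (hd : |x - y| ≤ lam) (hym : y - lam < m) (hmx : m < x) :
    m ∉ Mplus γ lam := by
  intro hm
  have hle := h.abs_sub_le_max hxy hm
  rw [sub_add_cancel_left, abs_neg] at hle
  rw [abs_le] at hd
  refine absurd ((le_abs_self lam).trans hle) (not_le.2 (max_lt ?_ ?_)) <;>
    rw [abs_lt] <;> constructor <;> linarith

theorem measureReal_Iic_le_of_Ioc_null {ρ : Measure ℝ} [IsFiniteMeasure ρ] {a b : ℝ}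
    (h : ρ (Ioc a b) = 0) : (ρ (Iic b)).toReal ≤ (ρ (Iic a)).toReal := by
  refine ENNReal.toReal_mono (measure_ne_top _ _) ?_
  calc ρ (Iic b) ≤ ρ (Iic a ∪ Ioc a b) :=
        measure_mono fun x hx => (le_or_gt x a).imp id fun h' => ⟨h', hx⟩
    _ ≤ ρ (Iic a) + ρ (Ioc a b) := measure_union_le _ _
    _ = ρ (Iic a) := by rw [h, add_zero]

theorem measureReal_Iic_mono (ρ : Measure ℝ) [IsFiniteMeasure ρ] :
    Monotone fun x => (ρ (Iic x)).toReal := fun _ _ h =>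
  ENNReal.toReal_mono (measure_ne_top _ _) (measure_mono (Iic_subset_Iic.2 h))

theorem continuousWithinAt_measureReal_Iic (ρ : Measure ℝ) [IsFiniteMeasure ρ] (x : ℝ) :
    ContinuousWithinAt (fun x => (ρ (Iic x)).toReal) (Ioi x) x := by
  have h : Tendsto (ρ ∘ Iic) (𝓝[>] x) (𝓝 (ρ (⋂ r > x, Iic r))) :=
    tendsto_measure_biInter_gt (fun r _ => measurableSet_Iic.nullMeasurableSet)
      (fun i j _ hij => Iic_subset_Iic.2 hij) ⟨x + 1, by simp, measure_ne_top _ _⟩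
  have hx : (⋂ r > x, Iic r) = Iic x := by
    ext z
    simp only [mem_iInter, mem_Iic]
    exact ⟨fun H => le_of_forall_gt_imp_ge_of_dense H, fun H r hr => H.trans hr.le⟩
  rw [hx] at h
  exact (ENNReal.tendsto_toReal (measure_ne_top _ _)).comp h

theorem measurable_phiR (ρp ρm : Measure ℝ) [IsFiniteMeasure ρp] [IsFiniteMeasure ρm] :
    Measurable (phiR ρp ρm) :=
  (measureReal_Iic_mono ρm).measurable.sub (measureReal_Iic_mono ρp).measurable

theorem continuousWithinAt_phiR (ρp ρm : Measure ℝ) [IsFiniteMeasure ρp] [IsFiniteMeasure ρm]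
    (x : ℝ) : ContinuousWithinAt (phiR ρp ρm) (Ioi x) x :=
  (continuousWithinAt_measureReal_Iic ρm x).sub (continuousWithinAt_measureReal_Iic ρp x)

theorem abs_phiR_le (ρp ρm : Measure ℝ) [IsFiniteMeasure ρp] [IsFiniteMeasure ρm] (x : ℝ) :
    |phiR ρp ρm x| ≤ (ρm univ).toReal + (ρp univ).toReal := by
  have hm : (ρm (Iic x)).toReal ≤ (ρm univ).toReal :=
    ENNReal.toReal_mono (measure_ne_top _ _) (measure_mono (subset_univ _))
  have hp : (ρp (Iic x)).toReal ≤ (ρp univ).toReal :=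
    ENNReal.toReal_mono (measure_ne_top _ _) (measure_mono (subset_univ _))
  have hm0 : 0 ≤ (ρm (Iic x)).toReal := ENNReal.toReal_nonneg
  have hp0 : 0 ≤ (ρp (Iic x)).toReal := ENNReal.toReal_nonneg
  rw [phiR, abs_le]
  constructor <;> linarith

/-- The infimum of a right-continuous function over a sliding window is measurable. -/
theorem measurable_sInf_image_Icc {F : ℝ → ℝ} (hF : ∀ x, ContinuousWithinAt F (Ioi x) x)
    (hbdd : BddBelow (range F)) {lam : ℝ} (hlam : 0 ≤ lam) (hmeas : Measurable F) :
    Measurable fun y => sInf (F '' Icc (y - lam) (y + lam)) := by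
  refine measurable_of_Iio fun c => ?_
  have heq : (fun y => sInf (F '' Icc (y - lam) (y + lam))) ⁻¹' Iio c =
      {y | F (y + lam) < c} ∪ ⋃ q : {q : ℚ // F q < c}, Icc ((q : ℝ) - lam) (q + lam) := by
    ext y
    simp only [mem_preimage, mem_Iio, mem_union, mem_ofPred_eq, mem_iUnion, mem_Icc]
    rw [csInf_lt_iff (hbdd.mono (image_subset_range _ _))
      ((nonempty_Icc.2 (by linarith)).image _)]
    constructor
    · rintro ⟨_, ⟨x, hx, rfl⟩, hxc⟩
      rcases hx.2.eq_or_lt with h | h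
      · exact Or.inl (h ▸ hxc)
      · right
        have hev : ∀ᶠ z in 𝓝[>] x, F z < c ∧ z ∈ Ioo x (y + lam) :=
          ((hF x).eventually (gt_mem_nhds hxc)).and (Ioo_mem_nhdsGT h)
        obtain ⟨u, hu, hsub⟩ := (mem_nhdsGT_iff_exists_Ioo_subset).1 hev
        obtain ⟨q, hxq, hqu⟩ := exists_rat_btwn (mem_Ioi.1 hu)
        have hq := hsub ⟨hxq, hqu⟩
        exact ⟨⟨q, hq.1⟩, by linarith [hq.2.2], by linarith [hx.1]⟩
    · rintro (h | ⟨⟨q, hq⟩, h1, h2⟩)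
      · exact ⟨_, ⟨_, ⟨by linarith, le_rfl⟩, rfl⟩, h⟩
      · exact ⟨_, ⟨q, ⟨by linarith, by linarith⟩, rfl⟩, hq⟩
  rw [heq]
  exact (measurableSet_lt (hmeas.comp (measurable_id.add_const lam)) measurable_const).union
    (MeasurableSet.iUnion fun _ => measurableSet_Icc)

theorem bddBelow_range_neg_phiR (ρp ρm : Measure ℝ) [IsFiniteMeasure ρp] [IsFiniteMeasure ρm] :
    BddBelow (range fun x => -phiR ρp ρm x) :=
  ⟨-((ρm univ).toReal + (ρp univ).toReal), forall_mem_range.2 fun x =>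
    neg_le_neg (abs_le.1 (abs_phiR_le ρp ρm x)).2⟩

theorem measurable_psiR (ρp ρm : Measure ℝ) [IsFiniteMeasure ρp] [IsFiniteMeasure ρm]
    {lam : ℝ} (hlam : 0 ≤ lam) : Measurable (psiR ρp ρm lam) :=
  measurable_sInf_image_Icc (fun x => (continuousWithinAt_phiR ρp ρm x).neg)
    (bddBelow_range_neg_phiR ρp ρm) hlam (measurable_phiR ρp ρm).neg

theorem psiR_le (ρp ρm : Measure ℝ) [IsFiniteMeasure ρp] [IsFiniteMeasure ρm] {lam x y : ℝ}
    (h : |x - y| ≤ lam) : psiR ρp ρm lam y ≤ -phiR ρp ρm x := by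
  rw [abs_le] at h
  exact csInf_le ((bddBelow_range_neg_phiR ρp ρm).mono (image_subset_range _ _))
    ⟨x, ⟨by linarith, by linarith⟩, rfl⟩

theorem abs_psiR_le (ρp ρm : Measure ℝ) [IsFiniteMeasure ρp] [IsFiniteMeasure ρm]
    {lam : ℝ} (hlam : 0 ≤ lam) (y : ℝ) :
    |psiR ρp ρm lam y| ≤ (ρm univ).toReal + (ρp univ).toReal := by
  rw [abs_le]
  constructor
  · refine le_csInf ((nonempty_Icc.2 (by linarith)).image _) (forall_mem_image.2 fun x _ => ?_)
    exact neg_le_neg (abs_le.1 (abs_phiR_le ρp ρm x)).2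
  · have h1 := psiR_le ρp ρm (lam := lam) (x := y) (y := y) (by simpa using hlam)
    have h2 := (abs_le.1 (abs_phiR_le ρp ρm y)).1
    linarith

/-- If `x` is sent to `y` by an `∞`-cyclically monotone plan, then `-phiR` attains its minimum
over the window centred at `y` at the point `x`, up to the atoms of `ρp` and `ρm`. -/
theorem InfCM.phiR_add_psiR_eq_zero {γ : Measure (ℝ × ℝ)} (h : InfCM γ)
    {ρp ρm : Measure ℝ} [IsFiniteMeasure ρp] [IsFiniteMeasure ρm] {lam x y : ℝ}
    (hsp : mSupport ρp = Mplus γ lam) (hsm : mSupport ρm = Mminus γ lam)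
    (hxy : (x, y) ∈ mSupport γ) (hd : |x - y| ≤ lam)
    (hp : ρp {x} = 0) (hm : ρm {y + lam} = 0) :
    phiR ρp ρm x + psiR ρp ρm lam y = 0 := by
  have hlam : 0 ≤ lam := (abs_nonneg _).trans hd
  suffices hle : -phiR ρp ρm x ≤ psiR ρp ρm lam y by
    linarith [psiR_le ρp ρm hd]
  refine le_csInf ((nonempty_Icc.2 (by linarith)).image _) (forall_mem_image.2 fun z hz => ?_)
  simp only [phiR]
  rcases le_total x z with hxz | hzx
  · have hnull : ρm (Ioc x z) = 0 := by
      refine measure_mono_null (t := Ioo x (y + lam) ∪ {y + lam}) (fun w hw => ?_)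
        (measure_union_null (measure_eq_zero_of_disjoint_mSupport fun w hw => ?_) hm)
      · exact (hw.2.trans hz.2).lt_or_eq.imp (fun hlt => ⟨hw.1, hlt⟩) id
      · exact hsm ▸ h.notMem_Mminus hxy hd hw.1 hw.2
    linarith [measureReal_Iic_le_of_Ioc_null hnull, measureReal_Iic_mono ρp hxz]
  · have hnull : ρp (Ioc z x) = 0 := by
      refine measure_mono_null (t := Ioo (y - lam) x ∪ {x}) (fun w hw => ?_)
        (measure_union_null (measure_eq_zero_of_disjoint_mSupport fun w hw => ?_) hp)
      · exact hw.2.lt_or_eq.imp (fun hlt => ⟨hz.1.trans_lt hw.1, hlt⟩) id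
      · exact hsp ▸ h.notMem_Mplus hxy hd hw.1 hw.2
    linarith [measureReal_Iic_le_of_Ioc_null hnull, measureReal_Iic_mono ρm hzx]

/-- The pair (φ_r, ψ_r) is admissible for the dual problem at λ = λ_C and realizes the
maximal value 0: it is a pair of Kantorovich potentials. -/
theorem phiR_psiR_Kantorovich_potentials
    (μ ν : Measure ℝ)
    [IsProbabilityMeasure μ] [IsProbabilityMeasure ν] [NullSingletonClass μ] [NullSingletonClass ν]
    (hμ : CompactlySupported μ) (hν : CompactlySupported ν)
    (γ : Measure (ℝ × ℝ)) (hγ : IsOptimalPlan μ ν γ) (hcm : InfCM γ)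
    (ρp ρm : Measure ℝ) [IsFiniteMeasure ρp] [IsFiniteMeasure ρm]
    (hsp : mSupport ρp = Mplus γ (Winfty μ ν).toReal)
    (hsm : mSupport ρm = Mminus γ (Winfty μ ν).toReal)
    (hss : suppSigned ρp ρm = Mplus γ (Winfty μ ν).toReal ∪ Mminus γ (Winfty μ ν).toReal)
    (hatom : ∀ x₀, (LeftExtreme (Mplus γ (Winfty μ ν).toReal) x₀ ∨
        RightExtreme (Mplus γ (Winfty μ ν).toReal) x₀) → ρm {x₀} < ρp {x₀})
    :
    DualAdm μ ν (Winfty μ ν).toReal (phiR ρp ρm) (psiR ρp ρm (Winfty μ ν).toReal) ∧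
    ∫ x, phiR ρp ρm x ∂μ + ∫ y, psiR ρp ρm (Winfty μ ν).toReal y ∂ν = 0 := by
  have hlam : 0 ≤ (Winfty μ ν).toReal := ENNReal.toReal_nonneg
  have hφ : Integrable (phiR ρp ρm) μ :=
    .of_bound (measurable_phiR ρp ρm).aestronglyMeasurable _ (ae_of_all _ (abs_phiR_le ρp ρm))
  have hψ : Integrable (psiR ρp ρm (Winfty μ ν).toReal) ν :=
    .of_bound (measurable_psiR ρp ρm hlam).aestronglyMeasurable _
      (ae_of_all _ (abs_psiR_le ρp ρm hlam))
  refine ⟨⟨hφ, hψ, ae_of_all _ fun x => ae_of_all _ fun y hxy => ?_⟩, ?_⟩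
  · linarith [psiR_le ρp ρm hxy]
  have hfst := hγ.1.measurePreserving_fst
  have hsnd := hγ.1.measurePreserving_snd
  have hp : ∀ᵐ p ∂γ, ρp {p.1} = 0 := by
    refine hfst.quasiMeasurePreserving.ae (p := fun x => ρp {x} = 0) ?_
    simpa using (countable_setOf_measure_singleton_ne_zero ρp).ae_notMem μ
  have hm : ∀ᵐ p ∂γ, ρm {p.2 + (Winfty μ ν).toReal} = 0 := by
    refine hsnd.quasiMeasurePreserving.ae
      (p := fun y => ρm {y + (Winfty μ ν).toReal} = 0) ?_
    simpa using ((countable_setOf_measure_singleton_ne_zero ρm).preimage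
      (add_left_injective (Winfty μ ν).toReal)).ae_notMem ν
  have hsupp : ∀ᵐ p ∂γ, p ∈ mSupport γ := mem_ae_iff.2 (measure_compl_mSupport γ)
  have hzero : ∀ᵐ p ∂γ, phiR ρp ρm p.1 + psiR ρp ρm (Winfty μ ν).toReal p.2 = 0 := by
    filter_upwards [hp, hm, hsupp, hγ.ae_dist_le hμ hν] with p h1 h2 h3 h4
    exact hcm.phiR_add_psiR_eq_zero hsp hsm h3 h4 h1 h2
  have hφ_int : ∫ x, phiR ρp ρm x ∂μ = ∫ p, phiR ρp ρm p.1 ∂γ := by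
    rw [← integral_map hfst.aemeasurable (measurable_phiR ρp ρm).aestronglyMeasurable,
      hfst.map_eq]
  have hψ_int : ∫ y, psiR ρp ρm (Winfty μ ν).toReal y ∂ν =
      ∫ p, psiR ρp ρm (Winfty μ ν).toReal p.2 ∂γ := by
    rw [← integral_map hsnd.aemeasurable (measurable_psiR ρp ρm hlam).aestronglyMeasurable,
      hsnd.map_eq]
  rw [hφ_int, hψ_int]
  exact (integral_add (hfst.integrable_comp_of_integrable hφ)
    (hsnd.integrable_comp_of_integrable hψ)).symm.trans (integral_eq_zero_of_ae hzero)
end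
end

section
/- Let μ, ν be compactly supported, atomless Borel probability measures on ℝ, λ_C := W∞(μ,ν). Let γ, γ̄ be optimal transport plans for W∞ and assume γ̄ is ∞-cyclically monotone. Then M_γ̄^+ ⊆ M_γ^+ and M_γ̄^- ⊆ M_γ^-. In particular all ∞-cyclically monotone optimal plans have the same sets M^+ and M^-, and these are contained in M_γ^+ and M_γ^- respectively for every optimal plan γ. -/
open MeasureTheory Set Filter Topology
open scoped ENNReal NNReal

noncomputable section

/-- Two-point case of cyclical monotonicity, in pairwise form. -/
def PairMonotone (γ : Measure (ℝ × ℝ)) : Prop :=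
  ∀ p ∈ mSupport γ, ∀ q ∈ mSupport γ,
    max |p.1 - p.2| |q.1 - q.2| ≤ max |p.1 - q.2| |q.1 - p.2|

lemma InfCM.pairMonotone {γ : Measure (ℝ × ℝ)} (h : InfCM γ) : PairMonotone γ := by
  intro p hp q hq
  have key := h 1 ![p, q] (by
    intro i
    fin_cases i
    · exact hp
    · exact hq)
  have hsup : ∀ f : Fin 2 → ℝ, (⨆ i, f i) = max (f 0) (f 1) := by
    intro f
    apply le_antisymm
    · apply ciSup_le
      intro i
      fin_cases i
      · exact le_max_left _ _
      · exact le_max_right _ _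
    · have hb : BddAbove (Set.range f) := (Set.finite_range f).bddAbove
      exact max_le (le_ciSup hb 0) (le_ciSup hb 1)
  rw [hsup, hsup] at key
  simpa using key

lemma swap_mem_mSupport_map_swap {γ : Measure (ℝ × ℝ)} {p : ℝ × ℝ} :
    p.swap ∈ mSupport (γ.map Prod.swap) ↔ p ∈ mSupport γ := by
  constructor
  · intro h U hU hp
    have := h (Prod.swap ⁻¹' U) (hU.preimage continuous_swap) (by simpa using hp)
    rwa [Measure.map_apply measurable_swap (hU.preimage continuous_swap).measurableSet,
      ← Set.preimage_comp, Prod.swap_swap_eq, Set.preimage_id] at this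
  · intro h U hU hp
    rw [Measure.map_apply measurable_swap hU.measurableSet]
    exact h _ (hU.preimage continuous_swap) hp

lemma PairMonotone.map_swap {γ : Measure (ℝ × ℝ)} (h : PairMonotone γ) :
    PairMonotone (γ.map Prod.swap) := by
  intro p hp q hq
  have hp' := swap_mem_mSupport_map_swap.1 (show p.swap.swap ∈ _ by simpa using hp)
  have hq' := swap_mem_mSupport_map_swap.1 (show q.swap.swap ∈ _ by simpa using hq)
  have key := h _ hp' _ hq'
  simp only [Prod.fst_swap, Prod.snd_swap] at key
  rw [abs_sub_comm p.1 p.2, abs_sub_comm q.1 q.2, abs_sub_comm p.1 q.2, abs_sub_comm q.1 p.2,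
    max_comm |q.2 - p.1|]
  exact key

lemma IsCoupling.isProbabilityMeasure {μ ν : Measure ℝ} [IsProbabilityMeasure μ]
    {γ : Measure (ℝ × ℝ)} (h : IsCoupling μ ν γ) : IsProbabilityMeasure γ :=
  ⟨by rw [← Measure.fst_univ, h.1, measure_univ]⟩

lemma IsCoupling.map_swap {μ ν : Measure ℝ} {γ : Measure (ℝ × ℝ)} (h : IsCoupling μ ν γ) :
    IsCoupling ν μ (γ.map Prod.swap) :=
  ⟨by rw [Measure.fst_map_swap, h.2], by rw [Measure.snd_map_swap, h.1]⟩

lemma IsCoupling.ae_fst {μ ν : Measure ℝ} {γ : Measure (ℝ × ℝ)} (h : IsCoupling μ ν γ)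
    {P : ℝ → Prop} (hP : ∀ᵐ x ∂μ, P x) : ∀ᵐ p ∂γ, P p.1 := by
  rw [← h.1] at hP
  exact ae_of_ae_map measurable_fst.aemeasurable hP

lemma IsCoupling.ae_snd {μ ν : Measure ℝ} {γ : Measure (ℝ × ℝ)} (h : IsCoupling μ ν γ)
    {P : ℝ → Prop} (hP : ∀ᵐ y ∂ν, P y) : ∀ᵐ p ∂γ, P p.2 := by
  rw [← h.2] at hP
  exact ae_of_ae_map measurable_snd.aemeasurable hP

lemma IsCoupling.measure_fst {μ ν : Measure ℝ} {γ : Measure (ℝ × ℝ)} (h : IsCoupling μ ν γ)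
    {s : Set ℝ} (hs : MeasurableSet s) : γ {p | p.1 ∈ s} = μ s := by
  rw [← h.1, Measure.fst_apply hs]; rfl

lemma IsCoupling.measure_snd {μ ν : Measure ℝ} {γ : Measure (ℝ × ℝ)} (h : IsCoupling μ ν γ)
    {s : Set ℝ} (hs : MeasurableSet s) : γ {p | p.2 ∈ s} = ν s := by
  rw [← h.2, Measure.snd_apply hs]; rfl

/-- A pairwise monotone plan with a maximal rightward displacement at `a` does not cross the cut
`(a, a + lam)` backwards. -/
lemma PairMonotone.ae_not_crossing {γ : Measure (ℝ × ℝ)} {lam a : ℝ} (h : PairMonotone γ)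
    (hlam : ∀ᵐ p ∂γ, |p.1 - p.2| ≤ lam) (ha : (a, a + lam) ∈ mSupport γ) :
    ∀ᵐ p ∂γ, a < p.1 → a + lam ≤ p.2 := by
  by_contra hcon
  have hpos : γ ({p | ¬ (a < p.1 → a + lam ≤ p.2)} ∩ {p | |p.1 - p.2| ≤ lam}) ≠ 0 := by
    rw [measure_inter_conull hlam]
    exact hcon
  obtain ⟨q, ⟨hq, hql⟩, hqs⟩ := exists_mem_forall_mem_nhdsWithin_pos_measure hpos
  have hq_supp : q ∈ mSupport γ := fun U hU hqU =>
    hqs U (mem_nhdsWithin_of_mem_nhds (hU.mem_nhds hqU))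
  simp only [Set.mem_ofPred_eq, Classical.not_imp, not_le] at hq hql
  have key := (le_max_left _ _).trans (h _ ha _ hq_supp)
  simp only [sub_add_cancel_left, abs_neg] at key
  have h1 := abs_le.1 hql
  have h2 : |a - q.2| < lam := abs_lt.2 ⟨by linarith, by linarith⟩
  have h3 : |q.1 - (a + lam)| < lam := abs_lt.2 ⟨by linarith, by linarith⟩
  exact absurd (key.trans_lt (max_lt h2 h3)) (not_lt.2 (le_abs_self lam))

lemma PairMonotone.mem_mSupport_of_mem {μ ν : Measure ℝ} [IsProbabilityMeasure μ]
    [NullSingletonClass μ] [NullSingletonClass ν] {γ γbar : Measure (ℝ × ℝ)}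
    (hγ : IsCoupling μ ν γ) (hγbar : IsCoupling μ ν γbar) {lam a : ℝ}
    (hlam : ∀ᵐ p ∂γ, |p.1 - p.2| ≤ lam) (hlambar : ∀ᵐ p ∂γbar, |p.1 - p.2| ≤ lam)
    (hmono : PairMonotone γbar) (ha : (a, a + lam) ∈ mSupport γbar) :
    (a, a + lam) ∈ mSupport γ := by
  have := hγ.isProbabilityMeasure
  have hcross := hmono.ae_not_crossing hlambar ha
  have hμa : ∀ᵐ x ∂μ, x ≠ a := by simp [ae_iff]
  have hνb : ∀ᵐ y ∂ν, y ≠ a + lam := by simp [ae_iff]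
  have hcut : μ (Iio a) = ν (Iio (a + lam)) := by
    rw [← hγbar.measure_fst measurableSet_Iio, ← hγbar.measure_snd measurableSet_Iio]
    apply measure_congr
    filter_upwards [hcross, hlambar, hγbar.ae_fst hμa] with p h1 h2 h3
    have h4 := abs_le.1 h2
    apply propext
    change p.1 < a ↔ p.2 < a + lam
    constructor
    · intro h
      linarith
    · intro h
      by_contra hn
      exact absurd (h1 (lt_of_le_of_ne (not_lt.1 hn) (Ne.symm h3))) (not_le.2 h)
  have hback : ∀ᵐ p ∂γ, p.2 < a + lam → p.1 < a := by
    have hle : ({p : ℝ × ℝ | p.1 ∈ Iio a} : Set (ℝ × ℝ)) ≤ᵐ[γ] {p | p.2 ∈ Iio (a + lam)} := by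
      filter_upwards [hlam] with p h2 h
      have h4 := abs_le.1 h2
      change p.1 < a at h
      change p.2 < a + lam
      linarith
    have heq := ae_eq_of_ae_subset_of_measure_ge hle
      (by rw [hγ.measure_fst measurableSet_Iio, hγ.measure_snd measurableSet_Iio, hcut])
      (measurable_fst measurableSet_Iio).nullMeasurableSet (measure_ne_top _ _)
    filter_upwards [heq] with p hp h
    exact hp.mpr h
  intro U hU haU
  obtain ⟨ε, hε, hball⟩ := Metric.isOpen_iff.1 hU _ haU
  have hbox : ∀ p : ℝ × ℝ, |p.1 - a| < ε → |p.2 - (a + lam)| < ε → p ∈ U := by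
    intro p h1 h2
    apply hball
    rw [Metric.mem_ball, Prod.dist_eq, Real.dist_eq, Real.dist_eq]
    exact max_lt h1 h2
  rw [pos_iff_ne_zero]
  intro hU0
  have hUc : ∀ᵐ p ∂γ, p ∉ U := measure_eq_zero_iff_ae_notMem.1 hU0
  have hμ0 : μ (Ioo a (a + ε)) = 0 := by
    rw [← hγ.measure_fst measurableSet_Ioo, measure_eq_zero_iff_ae_notMem]
    filter_upwards [hUc, hback, hlam] with p h1 h2 h3 h4
    have h5 := abs_le.1 h3
    have h6 : a < p.1 ∧ p.1 < a + ε := h4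
    have h7 : a + lam ≤ p.2 := by
      by_contra hn
      linarith [h2 (not_le.1 hn)]
    exact h1 (hbox p (abs_lt.2 ⟨by linarith, by linarith⟩) (abs_lt.2 ⟨by linarith, by linarith⟩))
  have hν0 : ν (Ioo (a + lam - ε) (a + lam)) = 0 := by
    rw [← hγ.measure_snd measurableSet_Ioo, measure_eq_zero_iff_ae_notMem]
    filter_upwards [hUc, hback, hlam] with p h1 h2 h3 h4
    have h5 := abs_le.1 h3
    have h6 : a + lam - ε < p.2 ∧ p.2 < a + lam := h4
    have h7 := h2 h6.2
    exact h1 (hbox p (abs_lt.2 ⟨by linarith, by linarith⟩) (abs_lt.2 ⟨by linarith, by linarith⟩))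
  refine (ha (Metric.ball (a, a + lam) ε) Metric.isOpen_ball (Metric.mem_ball_self hε)).ne' ?_
  rw [measure_eq_zero_iff_ae_notMem]
  filter_upwards [hlambar, hγbar.ae_fst hμa, hγbar.ae_snd hνb,
    hγbar.ae_fst (measure_eq_zero_iff_ae_notMem.1 hμ0),
    hγbar.ae_snd (measure_eq_zero_iff_ae_notMem.1 hν0)] with p h1 h2 h3 h4 h5 h6
  rw [Metric.mem_ball, Prod.dist_eq, Real.dist_eq, Real.dist_eq, max_lt_iff] at h6
  have h7 := abs_lt.1 h6.1
  have h8 := abs_lt.1 h6.2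
  have h9 := abs_le.1 h1
  simp only at h7 h8
  have h10 : p.1 < a := lt_of_le_of_ne
    (not_lt.1 fun h => h4 ⟨h, by linarith⟩) h2
  exact h5 ⟨by linarith, by linarith⟩

/-- The transport distance of an optimal plan between compactly supported measures is almost
surely at most the (finite) optimal cost. -/
lemma IsOptimalPlan.ae_abs_sub_le {μ ν : Measure ℝ} (hμ : CompactlySupported μ)
    (hν : CompactlySupported ν) {γ : Measure (ℝ × ℝ)} (h : IsOptimalPlan μ ν γ) :
    ∀ᵐ p ∂γ, |p.1 - p.2| ≤ (Winfty μ ν).toReal := by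
  obtain ⟨K, hK, hK0⟩ := hμ
  obtain ⟨L, hL, hL0⟩ := hν
  obtain ⟨C, hC⟩ := Metric.isBounded_iff.1 (hK.union hL).isBounded
  have hfin : Winfty μ ν ≠ ∞ := by
    rw [← h.2]
    refine ((essSup_le_of_ae_le (ENNReal.ofReal C) ?_).trans_lt ENNReal.ofReal_lt_top).ne
    have hKae : ∀ᵐ x ∂μ, x ∈ K := hK0
    have hLae : ∀ᵐ y ∂ν, y ∈ L := hL0
    filter_upwards [h.1.ae_fst hKae, h.1.ae_snd hLae] with p h1 h2
    rw [edist_dist]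
    exact ENNReal.ofReal_le_ofReal (hC (Or.inl h1) (Or.inr h2))
  have hle : ∀ᵐ p ∂γ, edist p.1 p.2 ≤ costInf γ := ENNReal.ae_le_essSup _
  filter_upwards [hle] with p hp
  rw [h.2] at hp
  rw [← Real.dist_eq, dist_edist]
  exact ENNReal.toReal_mono hfin hp

/-- Every optimal plan attains all the maximal displacements of a cyclically monotone one. -/
lemma InfCM.displacement_subset {μ ν : Measure ℝ}
    [IsProbabilityMeasure μ] [IsProbabilityMeasure ν] [NullSingletonClass μ] [NullSingletonClass ν]
    (hμ : CompactlySupported μ) (hν : CompactlySupported ν)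
    {γ γbar : Measure (ℝ × ℝ)} (hγ : IsOptimalPlan μ ν γ)
    (hγbar : IsOptimalPlan μ ν γbar) (hcm : InfCM γbar) :
    Mplus γbar (Winfty μ ν).toReal ⊆ Mplus γ (Winfty μ ν).toReal ∧
     Mminus γbar (Winfty μ ν).toReal ⊆ Mminus γ (Winfty μ ν).toReal := by
  have hlam := hγ.ae_abs_sub_le hμ hν
  have hlambar := hγbar.ae_abs_sub_le hμ hν
  generalize (Winfty μ ν).toReal = lam at hlam hlambar ⊢
  have hswap : ∀ {η : Measure (ℝ × ℝ)}, (∀ᵐ p ∂η, |p.1 - p.2| ≤ lam) →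
      ∀ᵐ p ∂(η.map Prod.swap), |p.1 - p.2| ≤ lam := by
    intro η hη
    rw [ae_map_iff measurable_swap.aemeasurable
      (measurableSet_le (by fun_prop) measurable_const)]
    filter_upwards [hη] with p hp
    rwa [abs_sub_comm] at hp
  constructor
  · intro x hx
    exact hcm.pairMonotone.mem_mSupport_of_mem hγ.1 hγbar.1 hlam hlambar hx
  · intro x hx
    have hx' : (x - lam, x - lam + lam) ∈ mSupport (γbar.map Prod.swap) := by
      rw [sub_add_cancel]
      exact swap_mem_mSupport_map_swap.2 hx
    have key := hcm.pairMonotone.map_swap.mem_mSupport_of_mem hγ.1.map_swap hγbar.1.map_swap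
      (hswap hlam) (hswap hlambar) hx'
    rw [sub_add_cancel] at key
    exact (swap_mem_mSupport_map_swap (p := (x, x - lam))).1 key

/-- Minimal set of maximal displacements: if γ̄ is an ∞-cyclically monotone optimal plan
and γ is any optimal plan, then M_γ̄⁺ ⊆ M_γ⁺ and M_γ̄⁻ ⊆ M_γ⁻; in particular any two
∞-cyclically monotone optimal plans have the same sets of maximal displacement. -/
theorem Mplus_Mminus_minimality (μ ν : Measure ℝ)
    [IsProbabilityMeasure μ] [IsProbabilityMeasure ν] [NullSingletonClass μ] [NullSingletonClass ν]
    (hμ : CompactlySupported μ) (hν : CompactlySupported ν)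
    (γ γbar : Measure (ℝ × ℝ)) (hγ : IsOptimalPlan μ ν γ)
    (hγbar : IsOptimalPlan μ ν γbar) (hcm : InfCM γbar) :
    (Mplus γbar (Winfty μ ν).toReal ⊆ Mplus γ (Winfty μ ν).toReal ∧
     Mminus γbar (Winfty μ ν).toReal ⊆ Mminus γ (Winfty μ ν).toReal) ∧
    (InfCM γ →
      Mplus γbar (Winfty μ ν).toReal = Mplus γ (Winfty μ ν).toReal ∧
      Mminus γbar (Winfty μ ν).toReal = Mminus γ (Winfty μ ν).toReal) := by
  have hsub := hcm.displacement_subset hμ hν hγ hγbar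
  refine ⟨hsub, fun hcmγ => ?_⟩
  have hsub' := hcmγ.displacement_subset hμ hν hγbar hγ
  exact ⟨hsub.1.antisymm hsub'.1, hsub.2.antisymm hsub'.2⟩

end
end
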